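/- arXiv:1908.03776 — 2 statements merged into one kernel-verified Lean document; each statement's English description precedes it below -/
import Mathlib

section
/- Let 0 < a < π/2 and consider the two points x₁ = (-a) and x₂ = (a) on the circle ℝ/2πℤ, with equal weights. Then the geodesic midpoint x̄ = 0 is the unique global minimizer of the Riemannian center-of-mass energy E(x) = d(x, x₁)² + d(x, x₂)²: one has E(0) = 2a², and E(x) > 2a² for every x ≠ 0 in ℝ/2πℤ. -/
open Real

/-- On the circle `ℝ/2πℤ` with its quotient (geodesic/angular) metric, for `0 < a < π/2`
and the two points `x₁ = (-a)` and `x₂ = (a)` with equal weights, the geodesic midpoint `0`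
is the unique global minimizer of the Riemannian center-of-mass energy
`E(x) = d(x,x₁)² + d(x,x₂)²`: one has `E(0) = 2a²` and `E(x) > 2a²` for every `x ≠ 0`. -/
theorem circle_center_of_mass_unique_global_min (a : ℝ) (ha : 0 < a) (ha' : a < π / 2)
    (E : AddCircle (2 * π) → ℝ)
    (hE : ∀ x : AddCircle (2 * π),
      E x = dist x ((↑(-a) : AddCircle (2 * π))) ^ 2 + dist x ((↑a : AddCircle (2 * π))) ^ 2) :
    E 0 = 2 * a ^ 2 ∧ ∀ x : AddCircle (2 * π), x ≠ 0 → 2 * a ^ 2 < E x := by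
  have hp : (2 * π) ≠ 0 := by positivity
  have hn : ‖(a : AddCircle (2 * π))‖ = a := by
    rw [(AddCircle.norm_coe_eq_abs_iff (2 * π) hp).2, abs_of_pos ha]
    rw [abs_of_pos ha, abs_of_pos (by positivity)]
    linarith [Real.pi_pos]
  constructor
  · rw [hE, dist_eq_norm, dist_eq_norm, zero_sub, zero_sub, norm_neg, AddCircle.coe_neg,
      norm_neg, hn]
    ring
  · intro x hx
    induction x using QuotientAddGroup.induction_on with
    | H t =>
    have h1 : dist (t : AddCircle (2 * π)) ((↑(-a) : AddCircle (2 * π))) ^ 2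
        = (t - (-a) - round ((2 * π)⁻¹ * (t - (-a))) * (2 * π)) ^ 2 := by
      rw [dist_eq_norm, ← AddCircle.coe_sub, AddCircle.norm_eq, sq_abs]
    have h2 : dist (t : AddCircle (2 * π)) ((↑a : AddCircle (2 * π))) ^ 2
        = (t - a - round ((2 * π)⁻¹ * (t - a)) * (2 * π)) ^ 2 := by
      rw [dist_eq_norm, ← AddCircle.coe_sub, AddCircle.norm_eq, sq_abs]
    have h3 := hE (t : AddCircle (2 * π))
    rw [h1, h2] at h3
    refine lt_of_lt_of_eq ?_ h3.symm
    generalize round ((2 * π)⁻¹ * (t - (-a))) = m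
    generalize round ((2 * π)⁻¹ * (t - a)) = n
    have hpi := Real.pi_pos
    rcases lt_trichotomy m n with h | h | h
    · have h' : (m : ℝ) + 1 ≤ n := by exact_mod_cast h
      have hk : 2 * a + 2 * π ≤ 2 * a + (n - m) * (2 * π) := by nlinarith
      nlinarith [sq_nonneg ((t - (-a) - m * (2 * π)) + (t - a - n * (2 * π)))]
    · subst h
      have ht : t - m * (2 * π) ≠ 0 := by
        intro h0
        apply hx
        refine (AddCircle.coe_eq_zero_iff (2 * π)).2 ⟨m, ?_⟩
        rw [zsmul_eq_mul]
        linarith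
      have := sq_pos_of_ne_zero ht
      nlinarith
    · have h' : (n : ℝ) + 1 ≤ m := by exact_mod_cast h
      have hk : 2 * π - 2 * a ≤ (m - n) * (2 * π) - 2 * a := by nlinarith
      nlinarith [sq_nonneg ((t - (-a) - m * (2 * π)) + (t - a - n * (2 * π)))]
end

section
/- Let 0 < a < π/2 and consider the two points x₁ = (-a) and x₂ = (a) on the circle ℝ/2πℤ, with equal weights, and the Riemannian center-of-mass energy E(x) = d(x, x₁)² + d(x, x₂)². Then the point y = (π), antipodal to the geodesic midpoint 0, is a local minimizer of E which is not a global minimizer: there exists δ > 0 such that E(y) ≤ E(x) for all x with d(x, y) < δ, and moreover E(y) = 2(π - a)² > 2a² = E(0). -/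
open Real

/-- On the circle `ℝ/2πℤ` with its quotient (geodesic/angular) metric, for `0 < a < π/2`
and the two points `x₁ = (-a)`, `x₂ = (a)` with equal weights and energy
`E(x) = d(x,x₁)² + d(x,x₂)²`, the point `y = (π)`, antipodal to the geodesic midpoint `0`,
is a local minimizer of `E` which is not a global minimizer: there is `δ > 0` with
`E(y) ≤ E(x)` whenever `d(x,y) < δ`, and `E(y) = 2(π-a)² > 2a² = E(0)`. -/
theorem circle_center_of_mass_local_min_antipodal (a : ℝ) (ha : 0 < a) (ha' : a < π / 2)
    (E : AddCircle (2 * π) → ℝ)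
    (hE : ∀ x : AddCircle (2 * π),
      E x = dist x ((↑(-a) : AddCircle (2 * π))) ^ 2 + dist x ((↑a : AddCircle (2 * π))) ^ 2) :
    (∃ δ > (0 : ℝ), ∀ x : AddCircle (2 * π),
        dist x ((↑π : AddCircle (2 * π))) < δ → E (↑π : AddCircle (2 * π)) ≤ E x) ∧
    E (↑π : AddCircle (2 * π)) = 2 * (π - a) ^ 2 ∧
    2 * a ^ 2 < 2 * (π - a) ^ 2 ∧
    E 0 = 2 * a ^ 2 := by
  have hpi := Real.pi_pos
  have hn : ∀ z : ℝ, |z| ≤ π → ‖(z : AddCircle (2 * π))‖ = |z| := by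
    intro z hz
    rw [AddCircle.norm_coe_eq_abs_iff (2 * π) (by positivity)]
    rw [abs_of_pos (by positivity : 0 < 2 * π)]
    linarith
  have key : ∀ t : ℝ, |t| ≤ a → E ((π + t : ℝ) : AddCircle (2 * π)) =
      (π - a - t) ^ 2 + (π - a + t) ^ 2 := by
    intro t ht
    obtain ⟨h1, h2⟩ := abs_le.mp ht
    have e1 : ((π + t : ℝ) : AddCircle (2 * π)) = ((t - π : ℝ) : AddCircle (2 * π)) := by
      have h := AddCircle.coe_add_period (2 * π) (t - π)
      rw [← h]
      congr 1
      ring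
    have d1 : dist ((π + t : ℝ) : AddCircle (2 * π)) ((-a : ℝ) : AddCircle (2 * π))
        = |t - π - -a| := by
      rw [e1, dist_eq_norm, ← AddCircle.coe_sub, hn]
      rw [abs_le]; constructor <;> linarith
    have d2 : dist ((π + t : ℝ) : AddCircle (2 * π)) ((a : ℝ) : AddCircle (2 * π))
        = |π + t - a| := by
      rw [dist_eq_norm, ← AddCircle.coe_sub, hn]
      rw [abs_le]; constructor <;> linarith
    rw [hE, d1, d2, sq_abs, sq_abs]
    ring
  have kpi : E (π : AddCircle (2 * π)) = 2 * (π - a) ^ 2 := by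
    have h := key 0 (by simpa using ha.le)
    rw [add_zero] at h
    rw [h]; ring
  refine ⟨⟨a, ha, ?_⟩, kpi, by nlinarith, ?_⟩
  · intro x hx
    induction x using QuotientAddGroup.induction_on with
    | H r =>
      change dist (r : AddCircle (2 * π)) _ < a at hx
      change _ ≤ E (r : AddCircle (2 * π))
      rw [dist_eq_norm, ← AddCircle.coe_sub, AddCircle.norm_eq] at hx
      generalize round ((2 * π)⁻¹ * (r - π)) = n at hx
      have e : (r : AddCircle (2 * π)) = ((π + (r - π - n * (2 * π)) : ℝ) : AddCircle (2 * π)) := by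
        have h : π + (r - π - n * (2 * π)) = r - n • (2 * π) := by
          rw [zsmul_eq_mul]; ring
        rw [h, AddCircle.coe_sub, AddCircle.coe_zsmul, AddCircle.coe_period, smul_zero, sub_zero]
      rw [e, key _ hx.le, kpi]
      nlinarith [sq_nonneg (r - π - n * (2 * π))]
  · have h0 : (0 : AddCircle (2 * π)) = ((0 : ℝ) : AddCircle (2 * π)) := by simp
    rw [hE, h0, dist_eq_norm, dist_eq_norm, ← AddCircle.coe_sub, ← AddCircle.coe_sub, hn, hn,
      sq_abs, sq_abs]
    · ring
    · rw [abs_le]; constructor <;> linarith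
    · rw [abs_le]; constructor <;> linarith
end
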